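/- Let (X, ℬ) be a measurable space and A a (nonnegative) kernel on X for which there exist constants 0 < δ ≤ M with δ ≤ A(x, X) ≤ M for every x ∈ X. Then the map μ ↦ Π_μ := μA/(μA)(X) from probability measures on X to probability measures on X is Lipschitz with respect to the total variation norm: for all probability measures μ, ν, ‖ Π_μ − Π_ν ‖_TV ≤ (M(M + δ)/δ²) ‖ μ − ν ‖_TV. -/

import Mathlib

open MeasureTheory ProbabilityTheory

/-- The total variation distance between two measures, defined as
`sup { |α(f) − β(f)| : f measurable, ‖f‖_∞ ≤ 1 }`. -/
noncomputable def tvDist {X : Type*} [MeasurableSpace X]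
    (α β : Measure X) : ℝ :=
  ⨆ f : {f : X → ℝ // Measurable f ∧ ∀ x, |f x| ≤ 1},
    |(∫ x, f.1 x ∂α) - ∫ x, f.1 x ∂β|

theorem bddAbove_range_abs_integral_sub {X : Type*} [MeasurableSpace X] (μ ν : Measure X)
    [IsFiniteMeasure μ] [IsFiniteMeasure ν] :
    BddAbove (Set.range fun f : {f : X → ℝ // Measurable f ∧ ∀ x, |f x| ≤ 1} =>
      |(∫ x, f.1 x ∂μ) - ∫ x, f.1 x ∂ν|) := by
  refine ⟨μ.real Set.univ + ν.real Set.univ, ?_⟩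
  rintro _ ⟨⟨f, -, hf⟩, rfl⟩
  have hμ := norm_integral_le_of_norm_le_const (μ := μ) (f := f) (.of_forall hf)
  have hν := norm_integral_le_of_norm_le_const (μ := ν) (f := f) (.of_forall hf)
  rw [one_mul, Real.norm_eq_abs] at hμ hν
  exact (abs_sub _ _).trans (add_le_add hμ hν)

theorem tvDist_nonneg {X : Type*} [MeasurableSpace X] (μ ν : Measure X) : 0 ≤ tvDist μ ν :=
  Real.iSup_nonneg fun _ => abs_nonneg _

/-- A measurable function bounded by `C` has integrals differing by at most `C` times the total
variation distance. -/
theorem abs_integral_sub_le_mul_tvDist {X : Type*} [MeasurableSpace X] (μ ν : Measure X)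
    [IsFiniteMeasure μ] [IsFiniteMeasure ν] {C : ℝ} (hC : 0 < C) {g : X → ℝ}
    (hg : Measurable g) (hgC : ∀ x, |g x| ≤ C) :
    |(∫ x, g x ∂μ) - ∫ x, g x ∂ν| ≤ C * tvDist μ ν := by
  have h := le_ciSup (bddAbove_range_abs_integral_sub μ ν)
    ⟨fun x => g x / C, hg.div_const C, fun x => by
      rw [abs_div, abs_of_pos hC]; exact (div_le_one hC).2 (hgC x)⟩
  simp only [integral_div] at h
  rw [← sub_div, abs_div, abs_of_pos hC, div_le_iff₀' hC] at h
  exact h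

theorem abs_div_sub_div_le {a b p q δ M T : ℝ} (hδ : 0 < δ) (hp : δ ≤ p) (hq : δ ≤ q)
    (hb : |b| ≤ M) (hab : |a - b| ≤ M * T) (hpq : |p - q| ≤ M * T) :
    |a / p - b / q| ≤ M * (M + δ) / δ ^ 2 * T := by
  have hp0 : 0 < p := hδ.trans_le hp
  have hq0 : 0 < q := hδ.trans_le hq
  have hM : 0 ≤ M := (abs_nonneg b).trans hb
  have hMT : 0 ≤ M * T := (abs_nonneg _).trans hab
  have e : a / p - b / q = (a - b) / p - b * (p - q) / (p * q) := by
    field_simp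
    ring
  calc |a / p - b / q| ≤ |a - b| / p + |b| * |p - q| / (p * q) := by
        rw [e]
        refine (abs_sub _ _).trans_eq ?_
        rw [abs_div, abs_div, abs_mul, abs_of_pos hp0, abs_of_pos (mul_pos hp0 hq0)]
    _ ≤ M * T / δ + M * (M * T) / (δ * δ) := by gcongr
    _ = M * (M + δ) / δ ^ 2 * T := by
        field_simp
        ring

theorem integral_inv_univ_smul {X : Type*} [MeasurableSpace X] (α : Measure X) (f : X → ℝ) :
    ∫ x, f x ∂((α Set.univ)⁻¹ • α) = (∫ x, f x ∂α) / α.real Set.univ := by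
  rw [integral_smul_measure, ENNReal.toReal_inv, smul_eq_mul, div_eq_inv_mul, Measure.real]

/-- For a nonnegative kernel `A` with `δ ≤ A(x,X) ≤ M` for all `x`, the map
`μ ↦ Π_μ := μA/(μA)(X)` on probability measures is Lipschitz in total variation
with constant `M(M+δ)/δ²`. -/
theorem stmt9 {X : Type*} [MeasurableSpace X] (A : Kernel X X)
    (δ M : ℝ) (hδ : 0 < δ) (hδM : δ ≤ M)
    (hlow : ∀ x, ENNReal.ofReal δ ≤ A x Set.univ)
    (hup : ∀ x, A x Set.univ ≤ ENNReal.ofReal M)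
    (μ ν : Measure X) [IsProbabilityMeasure μ] [IsProbabilityMeasure ν] :
    tvDist (((μ.bind (fun x => A x)) Set.univ)⁻¹ • (μ.bind (fun x => A x)))
        (((ν.bind (fun x => A x)) Set.univ)⁻¹ • (ν.bind (fun x => A x)))
      ≤ (M * (M + δ) / δ ^ 2) * tvDist μ ν := by
  have hM : 0 < M := hδ.trans_le hδM
  have : IsFiniteKernel A := ⟨⟨ENNReal.ofReal M, ENNReal.ofReal_lt_top, hup⟩⟩
  have hle (x : X) : (A x).real Set.univ ≤ M := ENNReal.toReal_le_of_le_ofReal hM.le (hup x)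
  have hge (x : X) : δ ≤ (A x).real Set.univ :=
    (ENNReal.ofReal_le_iff_le_toReal (measure_ne_top _ _)).1 (hlow x)
  have hmass : Measurable fun x => (A x).real Set.univ :=
    (A.measurable_coe MeasurableSet.univ).ennreal_toReal
  have hmass_abs (x : X) : |(A x).real Set.univ| ≤ M := by
    rw [abs_of_nonneg measureReal_nonneg]
    exact hle x
  have hmass_ge (ρ : Measure X) [IsProbabilityMeasure ρ] :
      δ ≤ ∫ x, (A x).real Set.univ ∂ρ := by
    have h := integral_mono (μ := ρ) (integrable_const δ)
      (Integrable.of_bound hmass.aestronglyMeasurable M (.of_forall hmass_abs)) hge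
    simpa using h
  have hbind (ρ : Measure X) [IsProbabilityMeasure ρ] {f : X → ℝ} (hf : Measurable f)
      (hf1 : ∀ x, |f x| ≤ 1) :
      ∫ y, f y ∂(ρ.bind fun x => A x) = ∫ x, ∫ y, f y ∂(A x) ∂ρ :=
    Kernel.integral_comp (η := A) (κ := Kernel.const Unit ρ) (a := ())
      (Integrable.of_bound hf.aestronglyMeasurable 1 (.of_forall hf1))
  have hbind_univ (ρ : Measure X) [IsProbabilityMeasure ρ] :
      (ρ.bind fun x => A x).real Set.univ = ∫ x, (A x).real Set.univ ∂ρ := by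
    simpa using hbind ρ (f := fun _ => 1) measurable_const (by simp)
  refine Real.iSup_le ?_ (mul_nonneg (by positivity) (tvDist_nonneg μ ν))
  rintro ⟨f, hf, hf1⟩
  have hg : Measurable fun x => ∫ y, f y ∂(A x) := hf.stronglyMeasurable.integral_kernel.measurable
  have hgM (x : X) : |∫ y, f y ∂(A x)| ≤ M := by
    have h := norm_integral_le_of_norm_le_const (μ := A x) (f := f) (.of_forall hf1)
    rw [one_mul, Real.norm_eq_abs] at h
    exact h.trans (hle x)
  have hb : |∫ x, ∫ y, f y ∂(A x) ∂ν| ≤ M := by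
    simpa using norm_integral_le_of_norm_le_const (μ := ν)
      (f := fun x => ∫ y, f y ∂(A x)) (.of_forall hgM)
  simp only [integral_inv_univ_smul, hbind_univ, hbind _ hf hf1]
  exact abs_div_sub_div_le hδ (hmass_ge μ) (hmass_ge ν) hb
    (abs_integral_sub_le_mul_tvDist μ ν hM hg hgM)
    (abs_integral_sub_le_mul_tvDist μ ν hM hmass hmass_abs)
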